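/- arXiv:2511.08420 — 4 statements merged into one kernel-verified Lean document; each statement's English description precedes it below -/
import Mathlib

section
/- The Beltrami–Klein map f_bk is injective on the closed upper half-plane { z ∈ ℂ : 0 ≤ im(z) }: if z₁, z₂ ∈ ℂ satisfy 0 ≤ im(z₁), 0 ≤ im(z₂) and f_bk(z₁) = f_bk(z₂), then z₁ = z₂. -/
open scoped ComplexConjugate

/-- The Beltrami–Klein map `f_bk(z) = (conj z − i)(z − i)/(1 + |z|²)`. -/
noncomputable def fbk (z : ℂ) : ℂ :=
  ((conj z) - Complex.I) * (z - Complex.I) / ((1 + Complex.normSq z : ℝ) : ℂ)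

theorem fbk_eq (z : ℂ) :
    fbk z = ⟨(Complex.normSq z - 1) / (1 + Complex.normSq z),
      -(2 * z.re) / (1 + Complex.normSq z)⟩ := by
  have num : (conj z - Complex.I) * (z - Complex.I) =
      ⟨Complex.normSq z - 1, -(2 * z.re)⟩ := by
    apply Complex.ext <;> simp [Complex.normSq_apply] <;> ring
  rw [fbk, num]
  apply Complex.ext
  · rw [Complex.div_ofReal_re]
  · rw [Complex.div_ofReal_im]

/-- The Beltrami–Klein map is injective on the closed upper half-plane. -/
theorem fbk_injOn_upper_half_plane (z₁ z₂ : ℂ) (h₁ : 0 ≤ z₁.im) (h₂ : 0 ≤ z₂.im)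
    (h : fbk z₁ = fbk z₂) : z₁ = z₂ := by
  rw [fbk_eq, fbk_eq, Complex.mk.injEq] at h
  obtain ⟨hre, him⟩ := h
  have pos₁ : 0 < 1 + Complex.normSq z₁ := by linarith [Complex.normSq_nonneg z₁]
  have pos₂ : 0 < 1 + Complex.normSq z₂ := by linarith [Complex.normSq_nonneg z₂]
  rw [div_eq_div_iff pos₁.ne' pos₂.ne'] at hre
  have normSq_eq : Complex.normSq z₁ = Complex.normSq z₂ := by linarith
  rw [normSq_eq, div_left_inj' pos₂.ne'] at him
  have re_eq : z₁.re = z₂.re := by linarith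
  rw [Complex.normSq_apply, Complex.normSq_apply, re_eq, add_right_inj] at normSq_eq
  exact Complex.ext re_eq ((mul_self_inj h₁ h₂).mp normSq_eq)
end

section
/- Let A : Matrix (Fin n) (Fin n) ℝ, B : Matrix (Fin n) (Fin m) ℝ, C : Matrix (Fin p) (Fin n) ℝ, D : Matrix (Fin p) (Fin m) ℝ, and let γ ≥ 0. Suppose there exists a symmetric matrix P : Matrix (Fin n) (Fin n) ℝ (Pᵀ = P) such that the symmetric block matrix L := [[Aᵀ*P + P*A + Cᵀ*C, P*B + Cᵀ*D], [Bᵀ*P + Dᵀ*C, Dᵀ*D − γ²·1]] of size (n+m)×(n+m) is negative semidefinite (i.e. (−L) is positive semidefinite). Write A_ℂ, B_ℂ, C_ℂ, D_ℂ for the entrywise complexifications. Then for every ω ∈ ℝ such that the matrix (i·ω)·1 − A_ℂ is invertible, and for every v ∈ EuclideanSpace ℂ (Fin m), one has ‖(C_ℂ * ((i·ω)·1 − A_ℂ)⁻¹ * B_ℂ + D_ℂ).mulVec v‖ ≤ γ·‖v‖ (Euclidean norms). -/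
/-- View a plain vector in `Fin p → ℂ` as an element of the Euclidean space `ℂᵖ`. -/
noncomputable def toE {p : ℕ} (v : Fin p → ℂ) : EuclideanSpace ℂ (Fin p) :=
  (WithLp.equiv 2 (Fin p → ℂ)).symm v

/-- View an element of the Euclidean space `ℂᵐ` as a plain vector in `Fin m → ℂ`. -/
noncomputable def ofE {m : ℕ} (v : EuclideanSpace ℂ (Fin m)) : Fin m → ℂ :=
  (WithLp.equiv 2 (Fin m → ℂ)) v

namespace Matrix

open scoped ComplexOrder MatrixOrder Norms.L2Operator

/-- The entrywise complexification of a real positive semidefinite matrix is positive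
semidefinite. -/
theorem PosSemidef.map_ofReal {ι : Type*} [Fintype ι] {M : Matrix ι ι ℝ} (hM : M.PosSemidef) :
    (M.map Complex.ofReal).PosSemidef := by
  classical
  obtain ⟨N, rfl⟩ := CStarAlgebra.nonneg_iff_eq_star_mul_self.mp hM.nonneg
  rw [star_eq_conjTranspose]
  have h : (Nᴴ * N).map Complex.ofReal = (N.map Complex.ofReal)ᴴ * N.map Complex.ofReal := by
    ext i j
    simp [mul_apply]
  rw [h]
  exact posSemidef_conjTranspose_mul_self _

theorem star_dotProduct_self_eq_norm_sq {ι : Type*} [Fintype ι] (w : ι → ℂ) :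
    star w ⬝ᵥ w = ((‖WithLp.toLp 2 w‖ ^ 2 : ℝ) : ℂ) := by
  rw [dotProduct_comm, ← EuclideanSpace.inner_toLp_toLp, inner_self_eq_norm_sq_to_K]
  simp

/-- If `γ² - Tᴴ T` is positive semidefinite, then `T` has Euclidean operator norm at most `γ`. -/
theorem norm_mulVec_le_of_posSemidef {m p : Type*} [Fintype m] [DecidableEq m] [Fintype p]
    {T : Matrix p m ℂ} {γ : ℝ} (hγ : 0 ≤ γ)
    (hT : (((γ : ℂ) ^ 2) • (1 : Matrix m m ℂ) - Tᴴ * T).PosSemidef) (v : m → ℂ) :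
    ‖WithLp.toLp 2 (T *ᵥ v)‖ ≤ γ * ‖WithLp.toLp 2 v‖ := by
  have h := hT.dotProduct_mulVec_nonneg v
  rw [sub_mulVec, smul_mulVec, one_mulVec, dotProduct_sub, dotProduct_smul, ← mulVec_mulVec,
    dotProduct_mulVec, ← star_mulVec, star_dotProduct_self_eq_norm_sq,
    star_dotProduct_self_eq_norm_sq, smul_eq_mul] at h
  have h' : ‖WithLp.toLp 2 (T *ᵥ v)‖ ^ 2 ≤ (γ * ‖WithLp.toLp 2 v‖) ^ 2 := by
    rw [mul_pow]
    exact_mod_cast sub_nonneg.mp h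
  exact le_of_sq_le_sq h' (by positivity)

/-- On the graph of a state response `G` at a purely imaginary frequency, the matrix of the
bounded real inequality compresses to `Tᴴ T - γ²` with `T = C G + D`. -/
theorem conjTranspose_fromRows_mul_fromBlocks_mul_fromRows
    {n m p : Type*} [Fintype n] [Fintype m] [DecidableEq m] [Fintype p]
    {A : Matrix n n ℂ} {B : Matrix n m ℂ} {G : Matrix n m ℂ} {s : ℂ}
    (C : Matrix p n ℂ) (D : Matrix p m ℂ) (P : Matrix n n ℂ) (c : ℂ)
    (hs : star s = -s) (hG : A * G + B = s • G) :
    (fromRows G (1 : Matrix m m ℂ))ᴴ *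
        fromBlocks (Aᴴ * P + P * A + Cᴴ * C) (P * B + Cᴴ * D)
          (Bᴴ * P + Dᴴ * C) (Dᴴ * D - c • (1 : Matrix m m ℂ)) *
        fromRows G (1 : Matrix m m ℂ) =
      (C * G + D)ᴴ * (C * G + D) - c • (1 : Matrix m m ℂ) := by
  have hcancel : (A * G + B)ᴴ * (P * G) + Gᴴ * P * (A * G + B) = 0 := by
    rw [hG, conjTranspose_smul, hs, Matrix.smul_mul, Matrix.mul_smul, Matrix.mul_assoc, neg_smul,
      neg_add_cancel]
  rw [Matrix.mul_assoc, fromBlocks_mul_fromRows, conjTranspose_fromRows_eq_fromCols_conjTranspose,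
    fromCols_mul_fromRows, ← sub_eq_zero, ← hcancel]
  simp only [conjTranspose_add, conjTranspose_mul, conjTranspose_one, Matrix.mul_add,
    Matrix.add_mul, Matrix.mul_assoc, Matrix.one_mul, Matrix.mul_one]
  abel

end Matrix

open Matrix in
/-- LMI sufficiency direction of the Bounded Real Lemma on the imaginary axis:
feasibility of the LMI with a symmetric `P` certifies the gain bound
`σ_max(C(iωI − A)⁻¹B + D) ≤ γ` at every nonsingular point `iω` of the imaginary axis. -/
theorem bounded_real_lemma_imaginary_axis
    {n m p : ℕ}
    (A : Matrix (Fin n) (Fin n) ℝ) (B : Matrix (Fin n) (Fin m) ℝ)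
    (C : Matrix (Fin p) (Fin n) ℝ) (D : Matrix (Fin p) (Fin m) ℝ)
    (γ : ℝ) (hγ : 0 ≤ γ)
    (hLMI : ∃ P : Matrix (Fin n) (Fin n) ℝ, Pᵀ = P ∧
      (-(Matrix.fromBlocks
          (Aᵀ * P + P * A + Cᵀ * C) (P * B + Cᵀ * D)
          (Bᵀ * P + Dᵀ * C) (Dᵀ * D - γ ^ 2 • (1 : Matrix (Fin m) (Fin m) ℝ)))).PosSemidef) :
    ∀ ω : ℝ,
      IsUnit ((Complex.I * (ω : ℂ)) • (1 : Matrix (Fin n) (Fin n) ℂ) -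
        A.map Complex.ofReal) →
      ∀ v : EuclideanSpace ℂ (Fin m),
        ‖toE ((C.map Complex.ofReal *
            ((Complex.I * (ω : ℂ)) • (1 : Matrix (Fin n) (Fin n) ℂ) -
              A.map Complex.ofReal)⁻¹ * B.map Complex.ofReal +
            D.map Complex.ofReal).mulVec (ofE v))‖ ≤ γ * ‖v‖ := by
  obtain ⟨P, -, hP⟩ := hLMI
  intro ω hω v
  set s : ℂ := Complex.I * (ω : ℂ) with hs_def
  set A' := A.map Complex.ofReal with hA
  set B' := B.map Complex.ofReal with hB
  set C' := C.map Complex.ofReal with hC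
  set D' := D.map Complex.ofReal with hD
  have hs : star s = -s := by simp [hs_def]
  set R := s • (1 : Matrix (Fin n) (Fin n) ℂ) - A' with hR
  have hG : A' * (R⁻¹ * B') + B' = s • (R⁻¹ * B') := by
    have h : R * (R⁻¹ * B') = B' :=
      mul_nonsing_inv_cancel_left _ _ ((isUnit_iff_isUnit_det R).mp hω)
    nth_rw 1 [hR] at h
    rw [Matrix.sub_mul, Matrix.smul_mul, Matrix.one_mul] at h
    exact (sub_eq_iff_eq_add'.mp h).symm
  have hL : (-(fromBlocks (Aᵀ * P + P * A + Cᵀ * C) (P * B + Cᵀ * D)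
      (Bᵀ * P + Dᵀ * C) (Dᵀ * D - γ ^ 2 • (1 : Matrix (Fin m) (Fin m) ℝ)))).map Complex.ofReal =
      -fromBlocks (A'ᴴ * P.map Complex.ofReal + P.map Complex.ofReal * A' + C'ᴴ * C')
        (P.map Complex.ofReal * B' + C'ᴴ * D') (B'ᴴ * P.map Complex.ofReal + D'ᴴ * C')
        (D'ᴴ * D' - ((γ : ℂ) ^ 2) • (1 : Matrix (Fin m) (Fin m) ℂ)) := by
    ext (i | i) (j | j) <;>
      simp [hA, hB, hC, hD, mul_apply, one_apply, apply_ite Complex.ofReal]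
  open scoped ComplexOrder in
  have hW := hP.map_ofReal.conjTranspose_mul_mul_same
    (fromRows (R⁻¹ * B') (1 : Matrix (Fin m) (Fin m) ℂ))
  rw [hL, Matrix.mul_neg, Matrix.neg_mul,
    conjTranspose_fromRows_mul_fromBlocks_mul_fromRows C' D' _ _ hs hG, neg_sub,
    ← Matrix.mul_assoc] at hW
  exact norm_mulVec_le_of_posSemidef hγ hW (ofE v)
end

section
/- Let A : Matrix (Fin n) (Fin n) ℝ, B : Matrix (Fin n) (Fin m) ℝ, C : Matrix (Fin p) (Fin n) ℝ, D : Matrix (Fin p) (Fin m) ℝ, and let γ ≥ 0. Suppose there exists a symmetric positive semidefinite matrix P : Matrix (Fin n) (Fin n) ℝ such that the symmetric block matrix L := [[Aᵀ*P + P*A + Cᵀ*C, P*B + Cᵀ*D], [Bᵀ*P + Dᵀ*C, Dᵀ*D − γ²·1]] of size (n+m)×(n+m) is negative semidefinite (i.e. (−L) is positive semidefinite). Write A_ℂ, B_ℂ, C_ℂ, D_ℂ for the entrywise complexifications. Then for every s ∈ ℂ with 0 < re(s) such that s·1 − A_ℂ is invertible, and for every v ∈ EuclideanSpace ℂ (Fin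 m), one has ‖(C_ℂ * (s·1 − A_ℂ)⁻¹ * B_ℂ + D_ℂ).mulVec v‖ ≤ γ·‖v‖ (Euclidean norms). -/
open Matrix ComplexOrder MatrixOrder in
/-- The complexification of a real positive semidefinite matrix is positive semidefinite. -/
theorem Matrix.PosSemidef.map_ofReal_s18 {ι : Type*} [Fintype ι] {M : Matrix ι ι ℝ}
    (hM : M.PosSemidef) : (M.map Complex.ofReal).PosSemidef := by
  classical
  obtain ⟨N, rfl⟩ := CStarAlgebra.nonneg_iff_eq_star_mul_self.mp hM.nonneg
  rw [star_eq_conjTranspose]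
  have h : (Nᴴ * N).map Complex.ofReal = (N.map Complex.ofReal)ᴴ * N.map Complex.ofReal := by
    ext i j
    simp [Matrix.mul_apply]
  rw [h]
  exact Matrix.posSemidef_conjTranspose_mul_self _

open Matrix in
/-- The quadratic form of the bounded real matrix inequality, written in terms of the state
derivative `A x + B v` and the output `C x + D v`. -/
theorem star_dotProduct_boundedReal_mulVec {ι κ μ : Type*} [Fintype ι] [Fintype κ] [Fintype μ]
    [DecidableEq κ] (A P : Matrix ι ι ℂ) (B : Matrix ι κ ℂ) (C : Matrix μ ι ℂ) (D : Matrix μ κ ℂ)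
    (c : ℂ) (x : ι → ℂ) (v : κ → ℂ) :
    star (Sum.elim x v) ⬝ᵥ (fromBlocks (Aᴴ * P + P * A + Cᴴ * C) (P * B + Cᴴ * D)
        (Bᴴ * P + Dᴴ * C) (Dᴴ * D - c • (1 : Matrix κ κ ℂ)) *ᵥ Sum.elim x v) =
      star (A *ᵥ x + B *ᵥ v) ⬝ᵥ (P *ᵥ x) + star x ⬝ᵥ (P *ᵥ (A *ᵥ x + B *ᵥ v)) +
        star (C *ᵥ x + D *ᵥ v) ⬝ᵥ (C *ᵥ x + D *ᵥ v) - c * (star v ⬝ᵥ v) := by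
  rw [fromBlocks_mulVec, Function.star_sumElim, sumElim_dotProduct_sumElim]
  simp only [Sum.elim_comp_inl, Sum.elim_comp_inr, star_add, star_mulVec, add_mulVec, sub_mulVec,
    mulVec_add, dotProduct_add, add_dotProduct, dotProduct_sub, smul_mulVec, one_mulVec,
    dotProduct_smul, smul_eq_mul, ← mulVec_mulVec, ← dotProduct_mulVec]
  ring

open Matrix in
/-- The Hermitian self-product of a complex vector is its squared Euclidean norm. -/
theorem star_dotProduct_self_eq_norm_toE_sq {k : ℕ} (y : Fin k → ℂ) :
    star y ⬝ᵥ y = ((‖toE y‖ ^ 2 : ℝ) : ℂ) := by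
  rw [EuclideanSpace.norm_sq_eq]
  simp [dotProduct, toE, Complex.conj_mul']

open Matrix in
/-- LMI sufficiency direction of the Bounded Real Lemma on the open right half-plane:
feasibility of the LMI with a symmetric positive semidefinite `P` certifies the gain bound
`σ_max(C(sI − A)⁻¹B + D) ≤ γ` at every nonsingular point `s` with `re s > 0`. -/
theorem bounded_real_lemma_right_half_plane
    {n m p : ℕ}
    (A : Matrix (Fin n) (Fin n) ℝ) (B : Matrix (Fin n) (Fin m) ℝ)
    (C : Matrix (Fin p) (Fin n) ℝ) (D : Matrix (Fin p) (Fin m) ℝ)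
    (γ : ℝ) (hγ : 0 ≤ γ)
    (hLMI : ∃ P : Matrix (Fin n) (Fin n) ℝ, Pᵀ = P ∧ P.PosSemidef ∧
      (-(Matrix.fromBlocks
          (Aᵀ * P + P * A + Cᵀ * C) (P * B + Cᵀ * D)
          (Bᵀ * P + Dᵀ * C) (Dᵀ * D - γ ^ 2 • (1 : Matrix (Fin m) (Fin m) ℝ)))).PosSemidef) :
    ∀ s : ℂ, 0 < s.re →
      IsUnit (s • (1 : Matrix (Fin n) (Fin n) ℂ) - A.map Complex.ofReal) →
      ∀ v : EuclideanSpace ℂ (Fin m),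
        ‖toE ((C.map Complex.ofReal *
            (s • (1 : Matrix (Fin n) (Fin n) ℂ) - A.map Complex.ofReal)⁻¹ *
            B.map Complex.ofReal + D.map Complex.ofReal).mulVec (ofE v))‖ ≤ γ * ‖v‖ := by
  obtain ⟨P, -, hP, hL⟩ := hLMI
  intro s hs hU v
  have hP' := hP.map_ofReal_s18
  have hL' := hL.map_ofReal_s18
  set A' := A.map Complex.ofReal
  set B' := B.map Complex.ofReal
  set C' := C.map Complex.ofReal
  set D' := D.map Complex.ofReal
  set P' := P.map Complex.ofReal
  have hmap : (-(fromBlocks (Aᵀ * P + P * A + Cᵀ * C) (P * B + Cᵀ * D)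
      (Bᵀ * P + Dᵀ * C) (Dᵀ * D - γ ^ 2 • (1 : Matrix (Fin m) (Fin m) ℝ)))).map Complex.ofReal =
      -(fromBlocks (A'ᴴ * P' + P' * A' + C'ᴴ * C') (P' * B' + C'ᴴ * D')
      (B'ᴴ * P' + D'ᴴ * C') (D'ᴴ * D' - ((γ ^ 2 : ℝ) : ℂ) • (1 : Matrix (Fin m) (Fin m) ℂ))) := by
    ext (i | i) (j | j) <;>
      simp [A', B', C', D', P', Matrix.mul_apply, Matrix.one_apply, apply_ite Complex.ofReal]
  set w := ofE v with hw
  set x := (s • (1 : Matrix (Fin n) (Fin n) ℂ) - A')⁻¹ *ᵥ (B' *ᵥ w) with hx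
  have hstate : A' *ᵥ x + B' *ᵥ w = s • x := by
    have h : (s • (1 : Matrix (Fin n) (Fin n) ℂ) - A') *ᵥ x = B' *ᵥ w := by
      rw [hx, mulVec_mulVec, mul_nonsing_inv _ ((isUnit_iff_isUnit_det _).mp hU), one_mulVec]
    rw [← h, sub_mulVec, smul_mulVec, one_mulVec]
    abel
  have hout : (C' * (s • (1 : Matrix (Fin n) (Fin n) ℂ) - A')⁻¹ * B' + D') *ᵥ w =
      C' *ᵥ x + D' *ᵥ w := by
    simp only [add_mulVec, hx, mulVec_mulVec, Matrix.mul_assoc]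
  have hv : toE w = v := by simp [hw, toE, ofE]
  rw [hmap] at hL'
  rw [hout]
  open ComplexOrder in
  have hq := hL'.dotProduct_mulVec_nonneg (Sum.elim x w)
  rw [neg_mulVec, dotProduct_neg, star_dotProduct_boundedReal_mulVec, hstate,
    star_dotProduct_self_eq_norm_toE_sq, star_dotProduct_self_eq_norm_toE_sq, hv, star_smul,
    smul_dotProduct, mulVec_smul, dotProduct_smul, smul_eq_mul, smul_eq_mul, ← add_mul] at hq
  open ComplexOrder in
  have hxP := (Complex.nonneg_iff.mp (hP'.dotProduct_mulVec_nonneg x)).1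
  have hre := (Complex.nonneg_iff.mp hq).1
  simp only [Complex.neg_re, Complex.sub_re, Complex.add_re, Complex.mul_re, Complex.add_im,
    Complex.ofReal_re, Complex.ofReal_im, Complex.star_def, Complex.conj_re, Complex.conj_im]
    at hre
  have hsx := mul_nonneg hs.le hxP
  refine abs_le_of_sq_le_sq' ?_ (by positivity) |>.2
  rw [mul_pow]
  linarith
end

section
/- Let A : Matrix (Fin n) (Fin n) ℝ, B : Matrix (Fin n) (Fin m) ℝ, C : Matrix (Fin p) (Fin n) ℝ, D : Matrix (Fin p) (Fin m) ℝ. Assume (A, B) is controllable, i.e. for every v : Fin n → ℝ, if vᵀ·(A^k * B) = 0 for all k ∈ ℕ then v = 0, and (A, C) is observable, i.e. for every w : Fin n → ℝ, if (C * A^k).mulVec w = 0 for all k ∈ ℕ then w = 0. Write A_ℂ, B_ℂ, C_ℂ, D_ℂ for the entrywise complexifications, and suppose there exists ω₀ ∈ ℝ such that (i·ω₀)·1 − A_ℂ is not invertible (A has an imaginary-axis eigenvalue). Then for every M ∈ ℝ there exist ω ∈ ℝ and v ∈ EuclideanSpace ℂ (Fin m) such that (i·ω)·1 − A_ℂ is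 invertible, v ≠ 0, and ‖(C_ℂ * ((i·ω)·1 − A_ℂ)⁻¹ * B_ℂ + D_ℂ).mulVec v‖ > M·‖v‖. -/
open Matrix Filter Topology Asymptotics in
/-- The vectors `x` for which the `i`-th entry of `C (sI − A)⁻¹ x` stays bounded as `s = iω` tends
to `iω₀` along the imaginary axis. -/
def boundedResponse {n p : ℕ} (A : Matrix (Fin n) (Fin n) ℂ) (C : Matrix (Fin p) (Fin n) ℂ)
    (i : Fin p) (ω₀ : ℝ) : Submodule ℂ (Fin n → ℂ) where
  carrier := {x | (fun ω : ℝ => ((C * ((Complex.I * (ω : ℂ)) • (1 : Matrix (Fin n) (Fin n) ℂ) -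
    A)⁻¹) *ᵥ x) i) =O[𝓝[≠] ω₀] (fun _ => (1 : ℝ))}
  add_mem' {x y} hx hy := by
    simp only [Set.mem_ofPred_eq, mulVec_add, Pi.add_apply] at *
    exact hx.add hy
  zero_mem' := by
    simp only [Set.mem_ofPred_eq, mulVec_zero, Pi.zero_apply]
    exact isBigO_zero _ _
  smul_mem' c x hx := by
    simp only [Set.mem_ofPred_eq, mulVec_smul, Pi.smul_apply] at *
    exact hx.const_smul_left c

open Matrix Filter Topology in
theorem eventually_isUnit_resolvent {n : ℕ} (A : Matrix (Fin n) (Fin n) ℂ) (ω₀ : ℝ) :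
    ∀ᶠ ω : ℝ in 𝓝[≠] ω₀,
      IsUnit ((Complex.I * (ω : ℂ)) • (1 : Matrix (Fin n) (Fin n) ℂ) - A) := by
  have hfin : {ω : ℝ | A.charpoly.IsRoot (Complex.I * (ω : ℂ))}.Finite :=
    (A.charpoly.finite_setOfPred_isRoot A.charpoly_monic.ne_zero).preimage fun x _ y _ h => by
      simpa using h
  filter_upwards [nhdsNE_le_cofinite ω₀ hfin.compl_mem_cofinite] with ω hω
  rw [isUnit_iff_isUnit_det, isUnit_iff_ne_zero, smul_one_eq_diagonal, ← scalar_apply,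
    ← eval_charpoly]
  exact hω

open Matrix Filter Topology Asymptotics in
theorem mulVec_mem_boundedResponse {n p : ℕ} {A : Matrix (Fin n) (Fin n) ℂ}
    {C : Matrix (Fin p) (Fin n) ℂ} {i : Fin p} {ω₀ : ℝ} {x : Fin n → ℂ}
    (hx : x ∈ boundedResponse A C i ω₀) : A *ᵥ x ∈ boundedResponse A C i ω₀ := by
  have hs : (fun ω : ℝ => Complex.I * (ω : ℂ)) =O[𝓝[≠] ω₀] (fun _ => (1 : ℝ)) :=
    (Continuous.tendsto (by fun_prop) ω₀ |>.mono_left nhdsWithin_le_nhds).isBigO_one ℝ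
  have hb : (fun ω : ℝ => (Complex.I * (ω : ℂ)) *
      ((C * ((Complex.I * (ω : ℂ)) • (1 : Matrix (Fin n) (Fin n) ℂ) - A)⁻¹) *ᵥ x) i -
      (C *ᵥ x) i) =O[𝓝[≠] ω₀] (fun _ => (1 : ℝ)) := by
    refine IsBigO.sub ?_ (isBigO_const_const _ one_ne_zero _)
    simpa using hs.mul hx
  refine hb.congr' ?_ EventuallyEq.rfl
  filter_upwards [eventually_isUnit_resolvent A ω₀] with ω hω
  set s : ℂ := Complex.I * (ω : ℂ)
  have h1 : (s • (1 : Matrix (Fin n) (Fin n) ℂ) - A)⁻¹ * A =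
      s • (s • (1 : Matrix (Fin n) (Fin n) ℂ) - A)⁻¹ - 1 := by
    have h := nonsing_inv_mul _ ((isUnit_iff_isUnit_det _).1 hω)
    rw [mul_sub, mul_smul_comm, mul_one] at h
    exact eq_sub_of_add_eq (sub_eq_iff_eq_add'.1 h).symm
  rw [mulVec_mulVec, Matrix.mul_assoc, h1, Matrix.mul_sub, Matrix.mul_one, Matrix.mul_smul,
    sub_mulVec, smul_mulVec]
  simp only [Pi.sub_apply, Pi.smul_apply, smul_eq_mul]

open Matrix Filter Topology Asymptotics in
/-- An eigenvector for `iω₀` with bounded response is annihilated by the output. -/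
theorem mulVec_apply_eq_zero_of_mem_boundedResponse {n p : ℕ} {A : Matrix (Fin n) (Fin n) ℂ}
    {C : Matrix (Fin p) (Fin n) ℂ} {i : Fin p} {ω₀ : ℝ} {w : Fin n → ℂ}
    (hw : A *ᵥ w = (Complex.I * (ω₀ : ℂ)) • w) (hb : w ∈ boundedResponse A C i ω₀) :
    (C *ᵥ w) i = 0 := by
  have hs : Tendsto (fun ω : ℝ => Complex.I * (ω : ℂ) - Complex.I * (ω₀ : ℂ)) (𝓝[≠] ω₀)
      (𝓝 0) := by
    have : Continuous fun ω : ℝ => Complex.I * (ω : ℂ) - Complex.I * (ω₀ : ℂ) := by fun_prop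
    simpa using (this.tendsto ω₀).mono_left nhdsWithin_le_nhds
  have hlim := ((isLittleO_one_iff ℝ).2 hs).mul_isBigO hb
  simp only [mul_one] at hlim
  refine tendsto_nhds_unique (tendsto_const_nhds.congr' ?_) ((isLittleO_one_iff ℝ).1 hlim)
  filter_upwards [eventually_isUnit_resolvent A ω₀] with ω hω
  have h := nonsing_inv_mul _ ((isUnit_iff_isUnit_det _).1 hω)
  rw [← smul_eq_mul, ← Pi.smul_apply, ← mulVec_smul, sub_smul, ← hw]
  conv_lhs => rw [← Matrix.mul_one C, ← h, ← Matrix.mul_assoc, ← mulVec_mulVec, sub_mulVec, smul_mulVec,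
    one_mulVec]


open Matrix in
/-- Joint injectivity of a family of real matrices passes to their complexifications. -/
theorem eq_zero_of_forall_map_ofReal_mulVec_eq_zero {ι : Type*} {n p : ℕ}
    {F : ι → Matrix (Fin p) (Fin n) ℝ}
    (hF : ∀ w : Fin n → ℝ, (∀ k, F k *ᵥ w = 0) → w = 0) {w : Fin n → ℂ}
    (hw : ∀ k, (F k).map Complex.ofReal *ᵥ w = 0) : w = 0 := by
  have hre : (fun j => (w j).re) = 0 := hF _ fun k => by
    ext i
    simpa [mulVec, dotProduct] using congrArg Complex.re (congrFun (hw k) i)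
  have him : (fun j => (w j).im) = 0 := hF _ fun k => by
    ext i
    simpa [mulVec, dotProduct] using congrArg Complex.im (congrFun (hw k) i)
  ext j
  exact Complex.ext (congrFun hre j) (congrFun him j)

open Matrix in
/-- An invariant subspace of a controllable pair that contains the range of the input matrix is
the whole space. -/
theorem eq_top_of_controllable {n m : ℕ} {A : Matrix (Fin n) (Fin n) ℝ}
    {B : Matrix (Fin n) (Fin m) ℝ}
    (hctrb : ∀ v : Fin n → ℝ, (∀ k : ℕ, v ᵥ* (A ^ k * B) = 0) → v = 0)
    {V : Submodule ℂ (Fin n → ℂ)} (hA : ∀ x ∈ V, A.map Complex.ofReal *ᵥ x ∈ V)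
    (hB : ∀ u, B.map Complex.ofReal *ᵥ u ∈ V) : V = ⊤ := by
  by_contra hV
  obtain ⟨φ, hφ, hker⟩ := V.exists_le_ker_of_lt_top (lt_top_iff_ne_top.2 hV)
  obtain ⟨y, rfl⟩ := (dotProductEquiv ℂ (Fin n)).surjective φ
  refine hφ ((map_eq_zero_iff _ (dotProductEquiv ℂ (Fin n)).injective).2 ?_)
  have hmem : ∀ (k : ℕ) (u : Fin m → ℂ),
      (A.map Complex.ofReal) ^ k *ᵥ (B.map Complex.ofReal *ᵥ u) ∈ V := by
    intro k u
    induction k with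
    | zero => simpa using hB u
    | succ k ih =>
      rw [pow_succ', ← mulVec_mulVec]
      exact hA _ ih
  refine eq_zero_of_forall_map_ofReal_mulVec_eq_zero (F := fun k : ℕ => (A ^ k * B)ᵀ)
    (fun v hv => hctrb v fun k => by rw [← mulVec_transpose, hv k]) fun k => ?_
  have hmap : (A ^ k * B).map Complex.ofReal =
      (A.map Complex.ofReal) ^ k * B.map Complex.ofReal := by
    change (A ^ k * B).map Complex.ofRealHom =
      (A.map Complex.ofRealHom) ^ k * B.map Complex.ofRealHom
    rw [Matrix.map_mul, Matrix.map_pow]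
  change ((A ^ k * B).map Complex.ofReal)ᵀ *ᵥ y = 0
  rw [mulVec_transpose, hmap]
  refine dotProduct_eq_zero _ fun u => ?_
  rw [← dotProduct_mulVec, ← mulVec_mulVec]
  exact hker (hmem k u)

open Matrix in
/-- If the realization `(A, B, C, D)` is controllable and observable and `A` has an
imaginary-axis eigenvalue, then the largest singular value of
`T(iω) = C(iωI − A)⁻¹B + D` is unbounded over `ω ∈ ℝ`. -/
theorem gain_unbounded_of_imaginary_axis_eigenvalue
    {n m p : ℕ}
    (A : Matrix (Fin n) (Fin n) ℝ) (B : Matrix (Fin n) (Fin m) ℝ)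
    (C : Matrix (Fin p) (Fin n) ℝ) (D : Matrix (Fin p) (Fin m) ℝ)
    (hctrb : ∀ v : Fin n → ℝ, (∀ k : ℕ, Matrix.vecMul v (A ^ k * B) = 0) → v = 0)
    (hobsv : ∀ w : Fin n → ℝ, (∀ k : ℕ, (C * A ^ k).mulVec w = 0) → w = 0)
    (himag : ∃ ω₀ : ℝ, ¬ IsUnit ((Complex.I * (ω₀ : ℂ)) • (1 : Matrix (Fin n) (Fin n) ℂ) -
      A.map Complex.ofReal)) :
    ∀ M : ℝ, ∃ ω : ℝ, ∃ v : EuclideanSpace ℂ (Fin m),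
      IsUnit ((Complex.I * (ω : ℂ)) • (1 : Matrix (Fin n) (Fin n) ℂ) -
        A.map Complex.ofReal) ∧ v ≠ 0 ∧
      ‖toE ((C.map Complex.ofReal *
          ((Complex.I * (ω : ℂ)) • (1 : Matrix (Fin n) (Fin n) ℂ) -
            A.map Complex.ofReal)⁻¹ * B.map Complex.ofReal +
          D.map Complex.ofReal).mulVec (ofE v))‖ > M * ‖v‖ := by
  intro M
  by_contra! hM
  obtain ⟨ω₀, hω₀⟩ := himag
  obtain ⟨w, hw0, hw⟩ : ∃ w : Fin n → ℂ, w ≠ 0 ∧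
      ((Complex.I * (ω₀ : ℂ)) • (1 : Matrix (Fin n) (Fin n) ℂ) - A.map Complex.ofReal) *ᵥ w =
        0 := by
    rw [exists_mulVec_eq_zero_iff]
    simpa [isUnit_iff_isUnit_det] using hω₀
  have heig : A.map Complex.ofReal *ᵥ w = (Complex.I * (ω₀ : ℂ)) • w := by
    rw [sub_mulVec, smul_mulVec, one_mulVec, sub_eq_zero] at hw
    exact hw.symm
  have hB : ∀ (i : Fin p) (u : Fin m → ℂ), B.map Complex.ofReal *ᵥ u ∈
      boundedResponse (A.map Complex.ofReal) (C.map Complex.ofReal) i ω₀ := by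
    intro i u
    rcases eq_or_ne u 0 with rfl | hu
    · rw [mulVec_zero]
      exact Submodule.zero_mem _
    refine Asymptotics.IsBigO.of_bound (M * ‖toE u‖ + ‖(D.map Complex.ofReal *ᵥ u) i‖) ?_
    filter_upwards [eventually_isUnit_resolvent (A.map Complex.ofReal) ω₀] with ω hω
    have hu' : toE u ≠ 0 := fun h => hu (congrArg WithLp.ofLp h)
    have h := (PiLp.norm_apply_le _ i).trans (hM ω (toE u) hω hu')
    change ‖((_ + D.map Complex.ofReal) *ᵥ u) i‖ ≤ _ at h
    rw [add_mulVec, Pi.add_apply] at h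
    rw [mulVec_mulVec, norm_one, mul_one, ← sub_le_iff_le_add]
    exact (norm_sub_le_norm_add _ _).trans h
  have hCw : C.map Complex.ofReal *ᵥ w = 0 := by
    ext i
    refine mulVec_apply_eq_zero_of_mem_boundedResponse heig ?_
    rw [eq_top_of_controllable hctrb (fun _ => mulVec_mem_boundedResponse) (hB i)]
    exact Submodule.mem_top
  refine hw0 (eq_zero_of_forall_map_ofReal_mulVec_eq_zero hobsv fun k => ?_)
  have hmap : (C * A ^ k).map Complex.ofReal =
      C.map Complex.ofReal * (A.map Complex.ofReal) ^ k := by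
    change (C * A ^ k).map Complex.ofRealHom =
      C.map Complex.ofRealHom * (A.map Complex.ofRealHom) ^ k
    rw [Matrix.map_mul, Matrix.map_pow]
  rw [hmap]
  clear hmap
  induction k with
  | zero => simpa using hCw
  | succ k ih =>
    rw [pow_succ, ← Matrix.mul_assoc, ← mulVec_mulVec, heig, mulVec_smul, ih, smul_zero]
end
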